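/- Suppose all k groups are extreme (for each j, y_j = 0 or y_j = n_j, with n_j ≥ 1), only an intercept is used (m = 1 and x_j = 1 for all j, so p_j^E(β) = σ(β) for β ∈ ℝ), and let f be a probability density on (0,∞) that is strictly positive on a set of positive measure. Then ∫_ℝ ∫_0^∞ f(r) · L(r, β) dr dβ < ∞ if and only if there is at least one group with all successes (some j with y_j = n_j) and at least one group with all failures (some j with y_j = 0). -/

import Mathlib

open MeasureTheory Real Filter Finset

/-- The Beta function `B(a,b) = ∫₀¹ v^(a-1) (1-v)^(b-1) dv`. -/
noncomputable def betaFn (a b : ℝ) : ℝ :=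
  ∫ v in (0:ℝ)..1, v ^ (a - 1) * (1 - v) ^ (b - 1)

/-- The standard logistic function `σ(t) = exp t / (1 + exp t)`. -/
noncomputable def logistic (t : ℝ) : ℝ := Real.exp t / (1 + Real.exp t)

/-- Expected random effect `p_j^E(β) = σ(x_jᵀ β)`. -/
noncomputable def pE {k m : ℕ} (x : Fin k → Fin m → ℝ) (j : Fin k) (β : Fin m → ℝ) : ℝ :=
  logistic (∑ i, x j i * β i)

/-- The Beta-Binomial likelihood
`L(r,β) = ∏ⱼ C(nⱼ,yⱼ) B(yⱼ + r pⱼᴱ, nⱼ - yⱼ + r qⱼᴱ) / B(r pⱼᴱ, r qⱼᴱ)`. -/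
noncomputable def bbL {k m : ℕ} (x : Fin k → Fin m → ℝ) (n y : Fin k → ℕ)
    (r : ℝ) (β : Fin m → ℝ) : ℝ :=
  ∏ j : Fin k,
    ((n j).choose (y j) : ℝ) *
      betaFn ((y j : ℝ) + r * pE x j β) (((n j : ℝ) - (y j : ℝ)) + r * (1 - pE x j β)) /
      betaFn (r * pE x j β) (r * (1 - pE x j β))

lemma betaFn_eq_beta {a b : ℝ} (ha : 0 < a) (hb : 0 < b) :
    betaFn a b = ProbabilityTheory.beta a b := by
  rw [ProbabilityTheory.beta_eq_betaIntegralReal a b ha hb, Complex.betaIntegral, betaFn]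
  have h : ∫ v in (0:ℝ)..1, (v : ℂ) ^ ((a : ℂ) - 1) * (1 - (v : ℂ)) ^ ((b : ℂ) - 1) =
      ∫ v in (0:ℝ)..1, ((v ^ (a - 1) * (1 - v) ^ (b - 1) : ℝ) : ℂ) := by
    refine intervalIntegral.integral_congr fun v hv => ?_
    rw [Set.uIcc_of_le zero_le_one] at hv
    simp only [Complex.ofReal_mul]
    rw [Complex.ofReal_cpow hv.1, Complex.ofReal_cpow (sub_nonneg.2 hv.2)]
    push_cast
    rfl
  rw [h, intervalIntegral.integral_ofReal, Complex.ofReal_re]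

lemma betaFn_pos {a b : ℝ} (ha : 0 < a) (hb : 0 < b) : 0 < betaFn a b :=
  betaFn_eq_beta ha hb ▸ ProbabilityTheory.beta_pos ha hb

lemma betaFn_comm {a b : ℝ} (ha : 0 < a) (hb : 0 < b) : betaFn a b = betaFn b a := by
  rw [betaFn_eq_beta ha hb, betaFn_eq_beta hb ha, ProbabilityTheory.beta, ProbabilityTheory.beta,
    mul_comm, add_comm]

lemma betaFn_add_one {a b : ℝ} (ha : 0 < a) (hb : 0 < b) :
    betaFn (a + 1) b = a / (a + b) * betaFn a b := by
  have hab : 0 < a + b := add_pos ha hb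
  rw [betaFn_eq_beta (by positivity) hb, betaFn_eq_beta ha hb, ProbabilityTheory.beta,
    ProbabilityTheory.beta, add_right_comm, Real.Gamma_add_one ha.ne', Real.Gamma_add_one hab.ne']
  have := (Real.Gamma_pos_of_pos hab).ne'
  field_simp

lemma betaFn_nat_add_div {a b : ℝ} (ha : 0 < a) (hb : 0 < b) (n : ℕ) :
    betaFn (n + a) b / betaFn a b = ∏ i ∈ range n, (a + i) / (a + b + i) := by
  induction n with
  | zero => simp [(betaFn_pos ha hb).ne']
  | succ n ih =>
    rw [prod_range_succ, ← ih, show ((n + 1 : ℕ) : ℝ) + a = (n + a) + 1 by push_cast; ring,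
      betaFn_add_one (by positivity) hb, show (n : ℝ) + a + b = a + b + n by ring]
    ring

lemma betaFn_nat_add_div_le {a b : ℝ} (ha : 0 < a) (hb : 0 < b) {n : ℕ} (hn : 1 ≤ n) :
    betaFn (n + a) b / betaFn a b ≤ a / (a + b) := by
  obtain ⟨n, rfl⟩ := Nat.exists_eq_add_of_le' hn
  rw [betaFn_nat_add_div ha hb, prod_range_succ', Nat.cast_zero, add_zero, add_zero]
  refine mul_le_of_le_one_left (by positivity) (prod_le_one (fun i _ => by positivity) fun i _ => ?_)
  rw [div_le_one (by positivity)]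
  linarith

lemma pow_le_betaFn_nat_add_div {a b : ℝ} (ha : 0 < a) (hb : 0 < b) (n : ℕ) :
    (a / (a + b)) ^ n ≤ betaFn (n + a) b / betaFn a b := by
  rw [betaFn_nat_add_div ha hb]
  calc (a / (a + b)) ^ n = ∏ _i ∈ range n, a / (a + b) := by rw [prod_const, card_range]
    _ ≤ _ := prod_le_prod (fun i _ => by positivity) fun i _ => ?_
  rw [div_le_div_iff₀ (by positivity) (by positivity)]
  nlinarith [mul_nonneg (Nat.cast_nonneg (α := ℝ) i) hb.le]

/-- The contribution of a single group to the Beta-Binomial likelihood. -/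
noncomputable def groupFactor (n y : ℕ) (r p : ℝ) : ℝ :=
  (n.choose y : ℝ) * betaFn ((y : ℝ) + r * p) (((n : ℝ) - (y : ℝ)) + r * (1 - p)) /
    betaFn (r * p) (r * (1 - p))

lemma groupFactor_self (n : ℕ) (r p : ℝ) :
    groupFactor n n r p =
      betaFn (n + r * p) (r * (1 - p)) / betaFn (r * p) (r * (1 - p)) := by
  simp [groupFactor]

lemma groupFactor_zero (n : ℕ) {r p : ℝ} (hr : 0 < r) (hp : 0 < p) (hp1 : p < 1) :
    groupFactor n 0 r p = groupFactor n n r (1 - p) := by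
  have hq : 0 < 1 - p := sub_pos.2 hp1
  have ha : 0 < r * p := by positivity
  have hb : 0 < r * (1 - p) := by positivity
  have hc : 0 < n + r * (1 - p) := by positivity
  simp [groupFactor, betaFn_comm ha hb, betaFn_comm ha hc]

lemma groupFactor_self_le {n : ℕ} (hn : 1 ≤ n) {r p : ℝ} (hr : 0 < r) (hp : 0 < p) (hp1 : p < 1) :
    groupFactor n n r p ≤ p := by
  have hq : 0 < 1 - p := sub_pos.2 hp1
  rw [groupFactor_self]
  refine (betaFn_nat_add_div_le (by positivity) (by positivity) hn).trans_eq ?_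
  field_simp
  ring

lemma pow_le_groupFactor_self (n : ℕ) {r p : ℝ} (hr : 0 < r) (hp : 0 < p) (hp1 : p < 1) :
    p ^ n ≤ groupFactor n n r p := by
  have hq : 0 < 1 - p := sub_pos.2 hp1
  rw [groupFactor_self]
  refine le_trans (le_of_eq ?_)
    (pow_le_betaFn_nat_add_div (a := r * p) (b := r * (1 - p)) (by positivity) (by positivity) n)
  congr 1
  field_simp
  ring

lemma groupFactor_nonneg {n y : ℕ} (hy : y ≤ n) {r p : ℝ} (hr : 0 < r) (hp : 0 < p)
    (hp1 : p < 1) : 0 ≤ groupFactor n y r p := by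
  have hq : 0 < 1 - p := sub_pos.2 hp1
  have hyn : (0 : ℝ) ≤ n - y := sub_nonneg.2 (Nat.cast_le.2 hy)
  exact div_nonneg (mul_nonneg (Nat.cast_nonneg _) (betaFn_pos (by positivity) (by positivity)).le)
    (betaFn_pos (by positivity) (by positivity)).le

lemma logistic_pos (t : ℝ) : 0 < logistic t := by
  unfold logistic
  positivity

lemma logistic_lt_one (t : ℝ) : logistic t < 1 := by
  rw [logistic, div_lt_one (by positivity)]
  linarith

lemma half_le_logistic {t : ℝ} (ht : 0 ≤ t) : 1 / 2 ≤ logistic t := by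
  rw [logistic, div_le_div_iff₀ (by positivity) (by positivity)]
  linarith [Real.one_le_exp ht]

lemma logistic_le_half {t : ℝ} (ht : t ≤ 0) : logistic t ≤ 1 / 2 := by
  rw [logistic, div_le_div_iff₀ (by positivity) (by positivity)]
  linarith [Real.exp_le_one_iff.2 ht]

lemma logistic_mul_one_sub_le (t : ℝ) :
    logistic t * (1 - logistic t) ≤ 2 * (1 + t ^ 2)⁻¹ := by
  have he := Real.exp_pos t
  have h : logistic t * (1 - logistic t) = Real.exp t / (1 + Real.exp t) ^ 2 := by
    unfold logistic
    field_simp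
    ring
  rw [h, ← div_eq_mul_inv, div_le_div_iff₀ (by positivity) (by positivity)]
  rcases le_total 0 t with ht | ht
  · nlinarith [Real.quadratic_le_exp_of_nonneg ht]
  · have h1 := Real.quadratic_le_exp_of_nonneg (neg_nonneg.2 ht)
    have h2 : Real.exp t * Real.exp (-t) = 1 := by rw [← Real.exp_add]; simp
    nlinarith [mul_le_mul_of_nonneg_left h1 he.le]

lemma lintegral_lintegral_mul_eq_top {f : ℝ → ℝ} (hfm : Measurable f) (hf0 : ∀ r, 0 ≤ f r)
    (hf1 : ∫⁻ r in Set.Ioi (0:ℝ), ENNReal.ofReal (f r) = 1) {L : ℝ → ℝ → ℝ} {S : Set ℝ}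
    (hS : MeasurableSet S) (hSv : volume S = ⊤) {c : ℝ} (hc : 0 < c)
    (h : ∀ β ∈ S, ∀ r, 0 < r → c ≤ L r β) :
    ∫⁻ β : ℝ, ∫⁻ r in Set.Ioi (0:ℝ), ENNReal.ofReal (f r * L r β) = ⊤ := by
  rw [eq_top_iff]
  calc ⊤ = ∫⁻ _ in S, ENNReal.ofReal c := by
        rw [setLIntegral_const, hSv, ENNReal.mul_top (ENNReal.ofReal_pos.2 hc).ne']
    _ ≤ ∫⁻ β in S, ∫⁻ r in Set.Ioi (0:ℝ), ENNReal.ofReal (f r * L r β) := by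
        refine setLIntegral_mono' hS fun β hβ => ?_
        calc ENNReal.ofReal c = ∫⁻ r in Set.Ioi (0:ℝ), ENNReal.ofReal (f r) * ENNReal.ofReal c := by
              rw [lintegral_mul_const _ hfm.ennreal_ofReal, hf1, one_mul]
          _ ≤ _ := by
              refine setLIntegral_mono' measurableSet_Ioi fun r hr => ?_
              rw [← ENNReal.ofReal_mul (hf0 r)]
              exact ENNReal.ofReal_le_ofReal (mul_le_mul_of_nonneg_left (h β hβ r hr) (hf0 r))
    _ ≤ _ := setLIntegral_le_lintegral _ _

lemma lintegral_lintegral_mul_lt_top {f : ℝ → ℝ} (hfm : Measurable f) (hf0 : ∀ r, 0 ≤ f r)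
    (hf1 : ∫⁻ r in Set.Ioi (0:ℝ), ENNReal.ofReal (f r) = 1) {L : ℝ → ℝ → ℝ} {g : ℝ → ℝ}
    (hg : Integrable g) (h : ∀ β r, 0 < r → L r β ≤ g β) :
    ∫⁻ β : ℝ, ∫⁻ r in Set.Ioi (0:ℝ), ENNReal.ofReal (f r * L r β) < ⊤ := by
  refine lt_of_le_of_lt (lintegral_mono fun β => ?_) hg.lintegral_lt_top
  calc ∫⁻ r in Set.Ioi (0:ℝ), ENNReal.ofReal (f r * L r β)
      ≤ ∫⁻ r in Set.Ioi (0:ℝ), ENNReal.ofReal (f r) * ENNReal.ofReal (g β) := by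
        refine setLIntegral_mono' measurableSet_Ioi fun r hr => ?_
        rw [← ENNReal.ofReal_mul (hf0 r)]
        exact ENNReal.ofReal_le_ofReal (mul_le_mul_of_nonneg_left (h β r hr) (hf0 r))
    _ = ENNReal.ofReal (g β) := by rw [lintegral_mul_const _ hfm.ennreal_ofReal, hf1, one_mul]

/-- Theorem 4: all groups extreme, intercept-only covariate, proper hyper-prior density `f`
on `(0,∞)` and flat improper prior on the intercept `β`. The posterior is proper iff the
data contain at least one all-successes group and at least one all-failures group. -/
theorem posterior_proper_iff_all_extreme_intercept (k : ℕ) (hk : 1 ≤ k)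
    (n y : Fin k → ℕ) (hn : ∀ j, 1 ≤ n j) (hext : ∀ j, y j = 0 ∨ y j = n j)
    (f : ℝ → ℝ) (hfm : Measurable f) (hf0 : ∀ r, 0 ≤ f r)
    (hf1 : ∫⁻ r in Set.Ioi (0:ℝ), ENNReal.ofReal (f r) = 1)
    (hfpos : 0 < volume {r : ℝ | 0 < r ∧ 0 < f r}) :
    (∫⁻ β : ℝ, ∫⁻ r in Set.Ioi (0:ℝ),
        ENNReal.ofReal (f r *
          ∏ j : Fin k,
            ((n j).choose (y j) : ℝ) *
              betaFn ((y j : ℝ) + r * logistic β)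
                (((n j : ℝ) - (y j : ℝ)) + r * (1 - logistic β)) /
              betaFn (r * logistic β) (r * (1 - logistic β)))) < ⊤
      ↔ (∃ j, y j = n j) ∧ (∃ j, y j = 0) := by
  change ∫⁻ β : ℝ, ∫⁻ r in Set.Ioi (0:ℝ),
    ENNReal.ofReal (f r * ∏ j, groupFactor (n j) (y j) r (logistic β)) < ⊤ ↔ _
  have hc : 0 < ∏ j, ((1 : ℝ) / 2) ^ n j := by positivity
  constructor
  · contrapose!
    intro h
    by_cases hs : ∃ j, y j = n j
    · have hy : ∀ j, y j = n j := fun j => (hext j).resolve_left (h hs j)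
      refine (lintegral_lintegral_mul_eq_top hfm hf0 hf1 (S := Set.Ici 0) measurableSet_Ici
        Real.volume_Ici hc fun β hβ r hr => ?_).ge
      refine prod_le_prod (fun j _ => by positivity) fun j _ => ?_
      rw [hy j]
      exact (pow_le_pow_left₀ (by norm_num) (half_le_logistic hβ) _).trans
        (pow_le_groupFactor_self _ hr (logistic_pos β) (logistic_lt_one β))
    · have hy : ∀ j, y j = 0 := fun j => (hext j).resolve_right fun hj => hs ⟨j, hj⟩
      refine (lintegral_lintegral_mul_eq_top hfm hf0 hf1 (S := Set.Iic 0) measurableSet_Iic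
        Real.volume_Iic hc fun β hβ r hr => ?_).ge
      refine prod_le_prod (fun j _ => by positivity) fun j _ => ?_
      have hβ' := logistic_le_half hβ
      have h0 := logistic_pos β
      rw [hy j, groupFactor_zero _ hr h0 (logistic_lt_one β)]
      exact (pow_le_pow_left₀ (by norm_num) (by linarith) _).trans
        (pow_le_groupFactor_self _ hr (by linarith) (by linarith))
  · rintro ⟨⟨s, hs⟩, t, ht⟩
    refine lintegral_lintegral_mul_lt_top hfm hf0 hf1 (integrable_inv_one_add_sq.const_mul 2)
      fun β r hr => le_trans ?_ (logistic_mul_one_sub_le β)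
    have h0 := logistic_pos β
    have h1 := logistic_lt_one β
    have hst : s ≠ t := by
      rintro rfl
      have := hn s
      omega
    have hnonneg : ∀ j, 0 ≤ groupFactor (n j) (y j) r (logistic β) := fun j =>
      groupFactor_nonneg (by have := hext j; omega) hr h0 h1
    have hle : ∀ j, groupFactor (n j) (y j) r (logistic β) ≤ 1 := fun j => by
      rcases hext j with hj | hj <;> rw [hj]
      · rw [groupFactor_zero _ hr h0 h1]
        exact (groupFactor_self_le (hn j) hr (by linarith) (by linarith)).trans (by linarith)
      · exact (groupFactor_self_le (hn j) hr h0 h1).trans h1.le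
    calc ∏ j, groupFactor (n j) (y j) r (logistic β)
        ≤ ∏ j ∈ {s, t}, groupFactor (n j) (y j) r (logistic β) :=
          prod_le_prod_of_subset_of_le_one (subset_univ _) (fun j _ => hnonneg j)
            fun j _ _ => hle j
      _ = groupFactor (n s) (y s) r (logistic β) * groupFactor (n t) (y t) r (logistic β) :=
          prod_pair hst
      _ ≤ logistic β * (1 - logistic β) := by
          refine mul_le_mul ?_ ?_ (hnonneg t) h0.le
          · rw [hs]
            exact groupFactor_self_le (hn s) hr h0 h1
          · rw [ht, groupFactor_zero _ hr h0 h1]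
            exact groupFactor_self_le (hn t) hr (by linarith) (by linarith)
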